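/- Let D ⊆ ℝ^n be nonempty closed, ℱ a Whitney family of cubes covering D^c with pairwise disjoint interiors, 10δ_Q ≤ dist(Q,D) ≤ 22δ_Q for all Q ∈ ℱ, and diameter comparability (1/2)δ_{Q'} ≤ δ_Q ≤ 2δ_{Q'} for intersecting cubes. Let {θ_Q}_{Q∈ℱ} ⊆ C^∞(ℝ^n) be a partition of unity on D^c with 0 ≤ θ_Q ≤ 1, supp θ_Q ⊆ 1.1Q, Σ_Q θ_Q = 1 on D^c, and |∂^k θ_Q| ≤ C_{n,k} δ_Q^{−|k|}. For each Q fix x_Q ∈ D with dist(x_Q, Q) = dist(Q, D). Then for any m ∈ ℕ and F ∈ C^m(ℝ^n), the function G defined by G(x) = Σ_Q θ_Q(x) J^m_{x_Q}F(x) for x ∉ D and G(x) = F(x) for x ∈ D belongs to C^m(ℝ^n), and ∂^i G(x) = ∂^i F(x) for every x ∈ D and every multi-index i with |i| ≤ m. -/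

import Mathlib

open MeasureTheory Metric Set

abbrev En (n : ℕ) := EuclideanSpace ℝ (Fin n)

noncomputable def pderiv1 {n : ℕ} (i : Fin n) (f : En n → ℝ) : En n → ℝ :=
  fun x => fderiv ℝ f x (EuclideanSpace.single i 1)

/-- The multi-index partial derivative `∂^k f`. -/
noncomputable def mderiv {n : ℕ} (k : Fin n → ℕ) (f : En n → ℝ) : En n → ℝ :=
  (List.finRange n).foldr (fun i g => (pderiv1 i)^[k i] g) f

/-- Multi-indices `k` with `|k| ≤ m`. -/
def multiIdxLe (n m : ℕ) : Finset (Fin n → ℕ) :=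
  (Fintype.piFinset fun _ => Finset.range (m+1)).filter fun k => ∑ i, k i ≤ m

/-- Multi-indices `k` with `|k| = m`. -/
def multiIdxEq (n m : ℕ) : Finset (Fin n → ℕ) :=
  (Fintype.piFinset fun _ => Finset.range (m+1)).filter fun k => ∑ i, k i = m

/-- The `m`-th Taylor polynomial `J^m_{x₀}F` of `F` at `x₀`, evaluated at `x`. -/
noncomputable def taylorJ {n : ℕ} (m : ℕ) (F : En n → ℝ) (x₀ x : En n) : ℝ :=
  ∑ k ∈ multiIdxLe n m,
    (mderiv k F x₀ / ∏ i, ((k i).factorial : ℝ)) * ∏ i, (x i - x₀ i) ^ (k i)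

/-- The closed axis-parallel cube with center `c` and half side length `t`. -/
def cubeSet {n : ℕ} (c : En n) (t : ℝ) : Set (En n) := {x | ∀ i, |x i - c i| ≤ t}

/-- The distance between two sets, `dist(A,B) = inf {|x−y| : x ∈ A, y ∈ B}`. -/
noncomputable def setDist {n : ℕ} (A B : Set (En n)) : ℝ :=
  sInf (Set.image2 dist A B)

/-! ### Words of partial derivatives -/

/-- Iterated partial derivatives along a word. -/
noncomputable def dw {n : ℕ} (w : List (Fin n)) (f : En n → ℝ) : En n → ℝ :=
  w.foldr (fun i g => pderiv1 i g) f

theorem dw_cons {n : ℕ} (i : Fin n) (w : List (Fin n)) (f : En n → ℝ) :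
    dw (i :: w) f = pderiv1 i (dw w f) := rfl

theorem dw_nil {n : ℕ} (f : En n → ℝ) : dw [] f = f := rfl

theorem dw_append {n : ℕ} (v w : List (Fin n)) (f : En n → ℝ) :
    dw (v ++ w) f = dw v (dw w f) := by
  simp [dw, List.foldr_append]

theorem dw_replicate {n : ℕ} (i : Fin n) (k : ℕ) (f : En n → ℝ) :
    dw (List.replicate k i) f = (pderiv1 i)^[k] f := by
  induction k with
  | zero => rfl
  | succ k ih => rw [List.replicate_succ, dw_cons, ih, Function.iterate_succ_apply']

/-- The sorted word of a multi-index. -/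
def wordOf {n : ℕ} (k : Fin n → ℕ) : List (Fin n) :=
  (List.finRange n).flatMap fun i => List.replicate (k i) i

theorem mderiv_eq_dw {n : ℕ} (k : Fin n → ℕ) (f : En n → ℝ) :
    mderiv k f = dw (wordOf k) f := by
  unfold mderiv wordOf
  induction List.finRange n with
  | nil => rfl
  | cons a l ih =>
    rw [List.foldr_cons, List.flatMap_cons, dw_append, dw_replicate, ih]

theorem wordOf_count {n : ℕ} (k : Fin n → ℕ) (j : Fin n) : (wordOf k).count j = k j := by
  unfold wordOf
  rw [List.count_flatMap]
  have h : (List.count j ∘ fun i => List.replicate (k i) i) = fun i => if i = j then k i else 0 := by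
    funext i
    simp [List.count_replicate]
  rw [h, ← List.ofFn_eq_map, List.sum_ofFn]
  simp

theorem wordOf_length {n : ℕ} (k : Fin n → ℕ) : (wordOf k).length = ∑ j, k j := by
  unfold wordOf
  rw [List.length_flatMap]
  simp only [List.length_replicate]
  rw [← List.ofFn_eq_map, List.sum_ofFn]

theorem sum_count {n : ℕ} (w : List (Fin n)) : ∑ j, w.count j = w.length := by
  induction w with
  | nil => simp
  | cons a l ih => simp [List.count_cons, Finset.sum_add_distrib, ih]

theorem wordOf_perm {n : ℕ} (w : List (Fin n)) : (wordOf fun j => w.count j).Perm w := by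
  rw [List.perm_iff_count]
  intro a
  rw [wordOf_count]

theorem contDiff_pderiv1 {n : ℕ} (i : Fin n) (f : En n → ℝ) (r : ℕ)
    (hf : ContDiff ℝ ((r + 1 : ℕ) : ℕ∞) f) : ContDiff ℝ (r : ℕ∞) (pderiv1 i f) := by
  unfold pderiv1
  have : ContDiff ℝ (r : ℕ∞) (fderiv ℝ f) := hf.fderiv_right (by norm_cast)
  exact this.clm_apply contDiff_const

theorem contDiff_dw {n : ℕ} (w : List (Fin n)) (f : En n → ℝ) (r : ℕ)
    (hf : ContDiff ℝ ((r + w.length : ℕ) : ℕ∞) f) : ContDiff ℝ (r : ℕ∞) (dw w f) := by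
  induction w generalizing r with
  | nil => simpa [dw_nil] using hf
  | cons i w ih =>
    rw [dw_cons]
    apply contDiff_pderiv1
    apply ih
    convert hf using 3
    simp; ring

theorem pderiv1_comm {n : ℕ} (i j : Fin n) (f : En n → ℝ)
    (hf : ContDiff ℝ (2 : ℕ∞) f) : pderiv1 i (pderiv1 j f) = pderiv1 j (pderiv1 i f) := by
  funext x
  have h1 : Differentiable ℝ (fderiv ℝ f) :=
    (hf.fderiv_right (m := 1) (by norm_cast)).differentiable (by norm_num)
  have hs : IsSymmSndFDerivAt ℝ f x := hf.contDiffAt.isSymmSndFDerivAt (by simp)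
  have key : ∀ a b : Fin n, pderiv1 a (pderiv1 b f) x =
      fderiv ℝ (fderiv ℝ f) x (EuclideanSpace.single a 1) (EuclideanSpace.single b 1) := by
    intro a b
    unfold pderiv1
    rw [fderiv_clm_apply (h1 x) (differentiableAt_const _)]
    simp
  rw [key, key]
  exact hs _ _

theorem dw_perm {n : ℕ} {v w : List (Fin n)} (h : v.Perm w) (f : En n → ℝ)
    (hf : ContDiff ℝ (v.length : ℕ∞) f) : dw v f = dw w f := by
  induction h with
  | nil => rfl
  | cons a _ ih =>
    rw [dw_cons, dw_cons, ih (hf.of_le (by simp))]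
  | swap a b l =>
    simp only [dw_cons]
    apply pderiv1_comm
    apply contDiff_dw l f 2
    convert hf using 3
    simp; ring
  | trans h1 h2 ih1 ih2 =>
    rw [ih1 hf, ih2]
    rw [← h1.length_eq]; exact hf

theorem dw_eq_iter {n : ℕ} (w : List (Fin n)) (f : En n → ℝ)
    (hf : ContDiff ℝ (w.length : ℕ∞) f) (x : En n) :
    dw w f x = iteratedFDeriv ℝ w.length f x (fun j => EuclideanSpace.single (w.get j) 1) := by
  induction w generalizing x with
  | nil => simp [dw_nil]
  | cons i w ih =>
    have hf' : ContDiff ℝ (w.length : ℕ∞) f := hf.of_le (by simp)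
    have hd : Differentiable ℝ (iteratedFDeriv ℝ w.length f) :=
      hf.differentiable_iteratedFDeriv (by simp; norm_cast; simp)
    rw [dw_cons]
    have : dw w f = fun x => iteratedFDeriv ℝ w.length f x
        (fun j => EuclideanSpace.single (w.get j) 1) := funext (ih hf')
    rw [this]
    simp only [List.length_cons]
    rw [iteratedFDeriv_succ_apply_left]
    unfold pderiv1
    rw [fderiv_continuousMultilinear_apply_const_apply (hd x)]
    rfl

theorem iter_basis {n k : ℕ} (w : Fin k → Fin n) (f : En n → ℝ)
    (hf : ContDiff ℝ (k : ℕ∞) f) (x : En n) :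
    iteratedFDeriv ℝ k f x (fun j => EuclideanSpace.single (w j) 1)
      = mderiv (fun j => (List.ofFn w).count j) f x := by
  rw [mderiv_eq_dw, dw_perm (wordOf_perm _) f (by rw [(wordOf_perm _).length_eq]; simpa using hf),
    dw_eq_iter _ f (by simpa using hf)]
  obtain ⟨l, hl⟩ : ∃ l, l = List.ofFn w := ⟨_, rfl⟩
  have hk : l.length = k := by simp [hl]
  have hw : w = fun j => l.get (j.cast hk.symm) := by
    subst hl; funext j; simp
  rw [← hl]
  clear hl
  subst hk
  subst hw
  rfl

theorem mderiv_eq_iter {n : ℕ} (k : Fin n → ℕ) (f : En n → ℝ)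
    (hf : ContDiff ℝ ((∑ j, k j : ℕ) : ℕ∞) f) (x : En n) :
    mderiv k f x = iteratedFDeriv ℝ (wordOf k).length f x
      (fun j => EuclideanSpace.single ((wordOf k).get j) 1) := by
  rw [mderiv_eq_dw, dw_eq_iter _ f (by rw [wordOf_length]; exact hf)]

theorem norm_multi_le {n k : ℕ} (T : ContinuousMultilinearMap ℝ (fun _ : Fin k => En n) ℝ) :
    ‖T‖ ≤ ∑ w : Fin k → Fin n, |T (fun j => EuclideanSpace.single (w j) 1)| := by
  classical
  apply ContinuousMultilinearMap.opNorm_le_bound (by positivity)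
  intro v
  have hv : v = fun j => ∑ i, (v j i) • (EuclideanSpace.single i (1:ℝ) : En n) := by
    funext j
    ext i
    simp [Finset.sum_apply, Pi.single_apply]
  have h1 : T v = ∑ w : Fin k → Fin n, T (fun j => (v j (w j)) •
      (EuclideanSpace.single (w j) (1:ℝ) : En n)) := by
    conv_lhs => rw [hv]
    exact T.toMultilinearMap.map_sum _
  rw [h1, Finset.sum_mul]
  refine (norm_sum_le _ _).trans (Finset.sum_le_sum fun w _ => ?_)
  rw [T.map_smul_univ, norm_smul, mul_comm, Real.norm_eq_abs, norm_prod]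
  gcongr with j
  exact PiLp.norm_apply_le _ _

/-! ### Taylor polynomials -/

theorem cast_lt_aux {p q : ℕ} (h : p < q) : (p : WithTop ℕ∞) < (((q : ℕ∞)) : WithTop ℕ∞) := by
  exact_mod_cast h

/-- Normalised powers `t^k / k!`, zero for negative `k`. -/
noncomputable def phi (k : ℤ) (t : ℝ) : ℝ :=
  if k < 0 then 0 else t ^ k.toNat / (k.toNat.factorial : ℝ)

theorem phi_hasDerivAt (k : ℤ) (t : ℝ) : HasDerivAt (phi k) (phi (k - 1) t) t := by
  rcases lt_trichotomy k 0 with h | h | h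
  · have h1 : phi k = fun _ => 0 := by funext s; simp [phi, h]
    have h2 : phi (k - 1) t = 0 := by
      have : k - 1 < 0 := by omega
      simp [phi, this]
    rw [h1, h2]; exact hasDerivAt_const _ _
  · subst h
    have h1 : phi 0 = fun _ => 1 := by funext s; simp [phi]
    have h2 : phi (0 - 1) t = 0 := by simp [phi]
    rw [h1, h2]; exact hasDerivAt_const _ _
  · obtain ⟨j, rfl⟩ : ∃ j : ℕ, k = j + 1 := ⟨(k - 1).toNat, by omega⟩
    have h1 : phi ((j : ℤ) + 1) = fun s => s ^ (j + 1) / ((j + 1).factorial : ℝ) := by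
      funext s
      have : ¬ ((j : ℤ) + 1 < 0) := by omega
      have h' : ((j : ℤ) + 1).toNat = j + 1 := by omega
      simp only [phi, if_neg this, h']
    have h2 : phi ((j : ℤ) + 1 - 1) t = t ^ j / (j.factorial : ℝ) := by
      have : ¬ ((j : ℤ) < 0) := by omega
      simp [phi]
    rw [h1, h2]
    have := (hasDerivAt_pow (j + 1) t).div_const ((j + 1).factorial : ℝ)
    refine this.congr_deriv ?_
    have hj : (j.factorial : ℝ) ≠ 0 := by positivity
    rw [Nat.factorial_succ]
    push_cast
    field_simp

theorem phi_contDiff (k : ℤ) : ContDiff ℝ (⊤ : ℕ∞) (phi k) := by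
  unfold phi
  by_cases h : k < 0
  · simp only [if_pos h]; exact contDiff_const
  · simp only [if_neg h]; fun_prop

/-- Normalised monomials. -/
noncomputable def mono {n : ℕ} (a : En n) (k : Fin n → ℤ) (x : En n) : ℝ :=
  ∏ j, phi (k j) (x j - a j)

theorem mono_contDiff {n : ℕ} (a : En n) (k : Fin n → ℤ) : ContDiff ℝ (⊤ : ℕ∞) (mono a k) := by
  unfold mono
  apply contDiff_prod
  intro j _
  apply (phi_contDiff _).comp
  fun_prop

theorem mono_pderiv {n : ℕ} (a : En n) (k : Fin n → ℤ) (i : Fin n) :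
    pderiv1 i (mono a k) = mono a (k - Pi.single i 1) := by
  classical
  funext x
  have h1 : ∀ j ∈ (Finset.univ : Finset (Fin n)),
      HasFDerivAt (fun x : En n => phi (k j) (x j - a j))
        (phi (k j - 1) (x j - a j) • (EuclideanSpace.proj j : En n →L[ℝ] ℝ)) x := by
    intro j _
    have hp : HasFDerivAt (fun x : En n => x j - a j) (EuclideanSpace.proj j : En n →L[ℝ] ℝ) x :=
      ((EuclideanSpace.proj j : En n →L[ℝ] ℝ).hasFDerivAt).sub_const _
    exact HasDerivAt.comp_hasFDerivAt (h₂ := phi (k j)) (f := fun x : En n => x j - a j) x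
      (phi_hasDerivAt (k j) (x j - a j)) hp
  have h2 := HasFDerivAt.finsetProd h1
  unfold pderiv1
  have h3 : fderiv ℝ (mono a k) x = _ := h2.fderiv
  rw [h3]
  simp only [_root_.sum_apply, _root_.smul_apply, smul_eq_mul]
  rw [Finset.sum_eq_single i]
  · unfold mono
    rw [← Finset.mul_prod_erase Finset.univ _ (Finset.mem_univ i)]
    simp only [Pi.sub_apply, Pi.single_eq_same]
    rw [mul_comm]
    congr 1
    · simp
    · apply Finset.prod_congr rfl
      intro j hj
      rw [Pi.single_eq_of_ne (Finset.ne_of_mem_erase hj)]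
      simp
  · intro j _ hj
    simp [hj]
  · simp

theorem dw_mono_sum {n : ℕ} {κ : Type*} (s : Finset κ) (C : κ → ℝ) (a : En n)
    (k : κ → Fin n → ℤ) (w : List (Fin n)) :
    dw w (fun x => ∑ l ∈ s, C l * mono a (k l) x) =
      fun x => ∑ l ∈ s, C l * mono a (fun j => k l j - (w.count j : ℤ)) x := by
  induction w with
  | nil => simp [dw_nil]
  | cons i w ih =>
    rw [dw_cons, ih]
    funext x
    have hd : ∀ l, Differentiable ℝ (mono a (fun j => k l j - (w.count j : ℤ))) := fun l =>
      (mono_contDiff _ _).differentiable (by simp)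
    unfold pderiv1
    rw [fderiv_fun_sum (fun l _ => ((hd l) x).const_mul _)]
    rw [_root_.sum_apply]
    apply Finset.sum_congr rfl
    intro l _
    rw [fderiv_const_mul ((hd l) x)]
    have := congrFun (mono_pderiv a (fun j => k l j - (w.count j : ℤ)) i) x
    unfold pderiv1 at this
    rw [_root_.smul_apply, this, smul_eq_mul]
    congr 2
    funext j
    by_cases hj : j = i
    · subst hj; simp; ring
    · simp [hj, Ne.symm hj]

theorem taylorJ_eq {n : ℕ} (m : ℕ) (F : En n → ℝ) (a : En n) :
    taylorJ m F a = fun x => ∑ k ∈ multiIdxLe n m, mderiv k F a * mono a (fun j => (k j : ℤ)) x := by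
  funext x
  unfold taylorJ
  apply Finset.sum_congr rfl
  intro k _
  rw [div_mul_eq_mul_div, mul_div_assoc, ← Finset.prod_div_distrib]
  unfold mono
  refine congrArg _ ?_
  apply Finset.prod_congr rfl
  intro j _
  simp [phi]

theorem taylorJ_contDiff {n : ℕ} (m : ℕ) (F : En n → ℝ) (a : En n) :
    ContDiff ℝ (⊤ : ℕ∞) (taylorJ m F a) := by
  rw [taylorJ_eq]
  apply ContDiff.sum
  intro k _
  exact contDiff_const.mul (mono_contDiff _ _)

theorem mem_multiIdxLe {n m : ℕ} (k : Fin n → ℕ) : k ∈ multiIdxLe n m ↔ ∑ i, k i ≤ m := by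
  unfold multiIdxLe
  simp only [Finset.mem_filter, Fintype.mem_piFinset, Finset.mem_range, and_iff_right_iff_imp]
  intro h i
  have := Finset.single_le_sum (f := k) (fun _ _ => Nat.zero_le _) (Finset.mem_univ i)
  omega

theorem mono_eq_zero {n : ℕ} (a : En n) (k : Fin n → ℤ) (x : En n) (j : Fin n) (hj : k j < 0) :
    mono a k x = 0 := by
  unfold mono
  apply Finset.prod_eq_zero (Finset.mem_univ j)
  simp [phi, hj]

theorem mono_zero {n : ℕ} (a : En n) (x : En n) : mono a (fun _ => 0) x = 1 := by
  simp [mono, phi]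

theorem mono_center {n : ℕ} (a : En n) (k : Fin n → ℤ) (hk : k ≠ fun _ => 0) :
    mono a k a = 0 := by
  obtain ⟨j, hj⟩ := Function.ne_iff.1 hk
  rcases lt_or_gt_of_ne hj with h | h
  · exact mono_eq_zero a k a j h
  · unfold mono
    apply Finset.prod_eq_zero (Finset.mem_univ j)
    have h0 : ¬ (k j < 0) := by omega
    have h1 : (k j).toNat ≠ 0 := by omega
    simp [phi, h1]

theorem dw_taylorJ_center {n : ℕ} (m : ℕ) (F : En n → ℝ) (a : En n) (w : List (Fin n))
    (hw : w.length ≤ m) : dw w (taylorJ m F a) a = mderiv (fun j => w.count j) F a := by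
  rw [taylorJ_eq, dw_mono_sum]
  dsimp only
  rw [Finset.sum_eq_single (fun j => w.count j)]
  · simp [mono_zero]
  · intro k _ hk
    rw [mono_center, mul_zero]
    intro h
    apply hk
    funext j
    have := congrFun h j
    omega
  · intro h
    exfalso
    apply h
    rw [mem_multiIdxLe, sum_count]
    exact hw

theorem dw_taylorJ_top {n : ℕ} (m : ℕ) (F : En n → ℝ) (a x : En n) (w : List (Fin n))
    (hw : w.length = m) : dw w (taylorJ m F a) x = mderiv (fun j => w.count j) F a := by
  rw [taylorJ_eq, dw_mono_sum]
  dsimp only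
  rw [Finset.sum_eq_single (fun j => w.count j)]
  · simp [mono_zero]
  · intro k hk hne
    rw [mem_multiIdxLe] at hk
    obtain ⟨j, hj⟩ : ∃ j, k j < w.count j := by
      by_contra hcon
      push Not at hcon
      apply hne
      have hs := sum_count w
      have h1 : ∑ j, w.count j = ∑ j, k j :=
        le_antisymm (Finset.sum_le_sum fun j _ => hcon j) (by omega)
      have := (Finset.sum_eq_sum_iff_of_le (fun j _ => hcon j)).1 h1
      funext j
      exact (this j (Finset.mem_univ j)).symm
    rw [mono_eq_zero _ _ _ j (by omega), mul_zero]
  · intro h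
    exfalso
    apply h
    rw [mem_multiIdxLe, sum_count]
    omega

theorem multi_ext {n k : ℕ} (S T : ContinuousMultilinearMap ℝ (fun _ : Fin k => En n) ℝ)
    (h : ∀ w : Fin k → Fin n, S (fun j => EuclideanSpace.single (w j) 1) =
      T (fun j => EuclideanSpace.single (w j) 1)) : S = T := by
  rw [← sub_eq_zero, ← norm_le_zero_iff]
  refine (norm_multi_le _).trans (le_of_eq ?_)
  apply Finset.sum_eq_zero
  intro w _
  simp [h w]

theorem iter_basis_dw {n k : ℕ} (w : Fin k → Fin n) (f : En n → ℝ)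
    (hf : ContDiff ℝ (k : ℕ∞) f) (x : En n) :
    iteratedFDeriv ℝ k f x (fun j => EuclideanSpace.single (w j) 1)
      = dw (List.ofFn w) f x := by
  rw [iter_basis w f hf, mderiv_eq_dw,
    dw_perm (wordOf_perm _) f (by rw [(wordOf_perm _).length_eq]; simpa using hf)]

theorem iter_taylor_center {n : ℕ} (m l : ℕ) (hl : l ≤ m) (F : En n → ℝ)
    (hF : ContDiff ℝ (m : ℕ∞) F) (a : En n) :
    iteratedFDeriv ℝ l (taylorJ m F a) a = iteratedFDeriv ℝ l F a := by
  apply multi_ext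
  intro w
  rw [iter_basis w F (hF.of_le (by exact_mod_cast hl)),
    iter_basis_dw w _ ((taylorJ_contDiff m F a).of_le (by exact_mod_cast le_top)),
    dw_taylorJ_center _ _ _ _ (by simpa using hl)]

theorem iter_taylor_top {n : ℕ} (m : ℕ) (F : En n → ℝ)
    (hF : ContDiff ℝ (m : ℕ∞) F) (a x : En n) :
    iteratedFDeriv ℝ m (taylorJ m F a) x = iteratedFDeriv ℝ m F a := by
  apply multi_ext
  intro w
  rw [iter_basis w F hF,
    iter_basis_dw w _ ((taylorJ_contDiff m F a).of_le (by exact_mod_cast le_top)),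
    dw_taylorJ_top _ _ _ _ _ (by simp)]

theorem taylor_remainder {n : ℕ} (m : ℕ) (F : En n → ℝ) (hF : ContDiff ℝ (m : ℕ∞) F)
    (a : En n) (r ε : ℝ) (hr : 0 ≤ r)
    (hε : ∀ t ∈ closedBall a r, ‖iteratedFDeriv ℝ m F t - iteratedFDeriv ℝ m F a‖ ≤ ε)
    (l : ℕ) (hl : l ≤ m) (x : En n) (hx : x ∈ closedBall a r) :
    ‖iteratedFDeriv ℝ (m - l) (taylorJ m F a - F) x‖ ≤ ε * r ^ l := by
  have hP : ∀ j : ℕ, ContDiff ℝ (j : ℕ∞) (taylorJ m F a) := fun j =>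
    (taylorJ_contDiff m F a).of_le (by exact_mod_cast le_top)
  have hR : ContDiff ℝ (m : ℕ∞) (taylorJ m F a - F) := (hP m).sub hF
  have hsub : ∀ j ≤ m, ∀ y, iteratedFDeriv ℝ j (taylorJ m F a - F) y =
      iteratedFDeriv ℝ j (taylorJ m F a) y - iteratedFDeriv ℝ j F y := fun j hj y =>
    iteratedFDeriv_sub_apply (hP j).contDiffAt
      (hF.of_le (by exact_mod_cast hj)).contDiffAt
  induction l generalizing x with
  | zero =>
    rw [Nat.sub_zero, hsub m le_rfl, iter_taylor_top m F hF, norm_sub_rev]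
    simpa using hε x hx
  | succ l ih =>
    have hε0 : 0 ≤ ε := (norm_nonneg _).trans (hε a (mem_closedBall_self hr))
    have e1 : m - l = (m - (l + 1)) + 1 := by omega
    have hd : Differentiable ℝ (iteratedFDeriv ℝ (m - (l+1)) (taylorJ m F a - F)) :=
      hR.differentiable_iteratedFDeriv (cast_lt_aux (by omega))
    have hb : ∀ y ∈ closedBall a r,
        ‖fderiv ℝ (iteratedFDeriv ℝ (m - (l+1)) (taylorJ m F a - F)) y‖ ≤ ε * r ^ l := by
      intro y hy
      rw [norm_fderiv_iteratedFDeriv, ← e1]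
      exact ih (by omega) y hy
    have h0 : iteratedFDeriv ℝ (m - (l+1)) (taylorJ m F a - F) a = 0 := by
      rw [hsub _ (by omega), iter_taylor_center _ _ (by omega) F hF, sub_self]
    have := (convex_closedBall a r).norm_image_sub_le_of_norm_fderiv_le
      (fun y _ => hd y) hb (mem_closedBall_self hr) hx
    rw [h0, sub_zero] at this
    refine this.trans ?_
    rw [pow_succ, ← mul_assoc]
    gcongr
    rwa [← dist_eq_norm]

/-! ### Gluing lemma -/

theorem glue_lemma {E : Type*} [NormedAddCommGroup E] [NormedSpace ℝ E] (D : Set E)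
    (hcl : IsClosed D) (m : ℕ) (H : E → ℝ) (hH0 : ∀ x ∈ D, H x = 0)
    (hHc : ∀ x ∉ D, ContDiffAt ℝ (m : ℕ∞) H x)
    (hHd : ∀ x₀ ∈ D, ∀ k ≤ m, ∀ ε > 0, ∃ η > 0, ∀ x ∉ D, dist x x₀ < η →
      ‖iteratedFDeriv ℝ k H x‖ ≤ ε * dist x x₀ ^ (m - k)) :
    ContDiff ℝ (m : ℕ∞) H ∧ ∀ x ∈ D, ∀ k ≤ m, iteratedFDeriv ℝ k H x = 0 := by
  classical
  let p : E → FormalMultilinearSeries ℝ E ℝ := fun x k =>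
    if x ∈ D then 0 else iteratedFDeriv ℝ k H x
  have hpD : ∀ x ∈ D, ∀ k, p x k = 0 := fun x hx k => by simp [p, hx]
  have hpc : ∀ x ∉ D, ∀ k, p x k = iteratedFDeriv ℝ k H x := fun x hx k => by simp [p, hx]
  have hbd : ∀ x₀ ∈ D, ∀ k ≤ m, ∀ ε > 0, ∀ᶠ x in nhds x₀, ‖p x k‖ ≤ ε * dist x x₀ ^ (m - k) := by
    intro x₀ hx₀ k hk ε hε
    obtain ⟨η, hη, h⟩ := hHd x₀ hx₀ k hk ε hε
    filter_upwards [Metric.ball_mem_nhds x₀ hη] with x hx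
    by_cases hxD : x ∈ D
    · rw [hpD x hxD, norm_zero]; positivity
    · rw [hpc x hxD]; exact h x hxD hx
  have hev : ∀ x ∉ D, ∀ k, (fun y => p y k) =ᶠ[nhds x] iteratedFDeriv ℝ k H := by
    intro x hx k
    filter_upwards [hcl.isOpen_compl.mem_nhds hx] with y hy
    exact hpc y hy k
  have hT : HasFTaylorSeriesUpTo (m : ℕ∞) H p := by
    refine ⟨?_, ?_, ?_⟩
    · intro x
      by_cases hx : x ∈ D
      · rw [hpD x hx, hH0 x hx]; rfl
      · rw [hpc x hx]; rfl
    · intro k hk x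
      have hk' : k < m := by exact_mod_cast hk
      by_cases hx : x ∈ D
      · rw [hpD x hx]
        have h0 : (0 : ContinuousMultilinearMap ℝ (fun _ : Fin k.succ => E) ℝ).curryLeft
          = 0 := rfl
        rw [h0]
        rw [hasFDerivAt_iff_isLittleO, Asymptotics.isLittleO_iff]
        intro ε hε
        filter_upwards [hbd x hx k hk'.le ε hε, Metric.ball_mem_nhds x one_pos] with y hy hy1
        rw [hpD x hx]
        simp only [sub_zero, _root_.zero_apply]
        refine hy.trans ?_
        rw [← dist_eq_norm]
        gcongr
        apply pow_le_of_le_one dist_nonneg (le_of_lt hy1) (by omega)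
      · rw [hpc x hx]
        refine HasFDerivAt.congr_of_eventuallyEq ?_ (hev x hx k)
        have hd : DifferentiableAt ℝ (iteratedFDeriv ℝ k H) x :=
          (hHc x hx).differentiableAt_iteratedFDeriv hk
        exact hd.hasFDerivAt
    · intro k hk
      have hk' : k ≤ m := by exact_mod_cast hk
      rw [continuous_iff_continuousAt]
      intro x
      by_cases hx : x ∈ D
      · have : Filter.Tendsto (fun x => p x k) (nhds x) (nhds (p x k)) := by
         rw [hpD x hx, Metric.tendsto_nhds]
         intro ε hε
         filter_upwards [hbd x hx k hk' (ε / 2) (by positivity),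
           Metric.ball_mem_nhds x one_pos] with y hy hy1
         rw [dist_zero_right]
         refine lt_of_le_of_lt hy ?_
         have : dist y x ^ (m - k) ≤ 1 := pow_le_one₀ dist_nonneg (le_of_lt hy1)
         nlinarith
        exact this
      · refine ContinuousAt.congr ?_ (hev x hx k).symm
        exact ((hHc x hx).iteratedFDeriv_right (m := 0) (by simpa using hk)).continuousAt
  refine ⟨hT.contDiff, fun x hx k hk => ?_⟩
  rw [← hT.eq_iteratedFDeriv (by exact_mod_cast hk) x, hpD x hx]

/-! ### Geometry of cubes -/

theorem cube_dist_center {n : ℕ} (c y : En n) (t : ℝ) (hy : y ∈ cubeSet c t) :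
    dist y c ≤ Real.sqrt n * |t| := by
  rw [EuclideanSpace.dist_eq]
  have : ∑ i, dist (y i) (c i) ^ 2 ≤ n * |t| ^ 2 := by
    calc ∑ i, dist (y i) (c i) ^ 2 ≤ ∑ _i : Fin n, |t| ^ 2 := by
          apply Finset.sum_le_sum
          intro i _
          have := hy i
          rw [Real.dist_eq]
          exact pow_le_pow_left₀ (abs_nonneg _) (this.trans (le_abs_self _)) 2
      _ = n * |t| ^ 2 := by simp
  calc _ ≤ Real.sqrt (n * |t| ^ 2) := Real.sqrt_le_sqrt this
    _ = Real.sqrt n * |t| := by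
      rw [Real.sqrt_mul (by positivity), Real.sqrt_sq (abs_nonneg _)]

theorem cube_bounded {n : ℕ} (c : En n) (t : ℝ) : Bornology.IsBounded (cubeSet c t) :=
  (Metric.isBounded_closedBall (x := c) (r := Real.sqrt n * |t|)).subset
    fun y hy => cube_dist_center c y t hy

theorem cube_diam_le {n : ℕ} (c : En n) (t : ℝ) (ht : 0 ≤ t) :
    diam (cubeSet c t) ≤ 2 * Real.sqrt n * t := by
  apply Metric.diam_le_of_forall_dist_le (by positivity)
  intro x hx y hy
  have h1 := cube_dist_center c x t hx
  have h2 := cube_dist_center c y t hy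
  rw [abs_of_nonneg ht] at h1 h2
  have := dist_triangle_right x y c
  linarith

theorem cube_diam_ge {n : ℕ} (c : En n) (t : ℝ) (ht : 0 ≤ t) :
    2 * Real.sqrt n * t ≤ diam (cubeSet c t) := by
  let u : En n := WithLp.toLp 2 (fun i => c i + t)
  let v : En n := WithLp.toLp 2 (fun i => c i - t)
  have hu : u ∈ cubeSet c t := by intro i; simp [u, abs_of_nonneg ht]
  have hv : v ∈ cubeSet c t := by intro i; simp [v, abs_of_nonneg ht]
  refine le_trans (le_of_eq ?_) (Metric.dist_le_diam_of_mem (cube_bounded c t) hu hv)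
  rw [EuclideanSpace.dist_eq]
  have : ∀ i, dist (u i) (v i) ^ 2 = (2 * t) ^ 2 := by
    intro i
    rw [Real.dist_eq, sq_abs]
    simp only [u, v]
    ring
  simp only [this]
  rw [Finset.sum_const, Finset.card_univ, Fintype.card_fin, nsmul_eq_mul,
    Real.sqrt_mul (by positivity), Real.sqrt_sq (by positivity)]
  ring

theorem cube_diam {n : ℕ} (c : En n) (t : ℝ) (ht : 0 ≤ t) :
    diam (cubeSet c t) = 2 * Real.sqrt n * t :=
  le_antisymm (cube_diam_le c t ht) (cube_diam_ge c t ht)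

theorem setDist_le {n : ℕ} (A B : Set (En n)) (a b : En n) (ha : a ∈ A) (hb : b ∈ B) :
    setDist A B ≤ dist a b := by
  apply csInf_le
  · refine ⟨0, ?_⟩
    rintro _ ⟨x, _, y, _, rfl⟩
    exact dist_nonneg
  · exact ⟨a, ha, b, hb, rfl⟩

theorem ball_subset_interior {n : ℕ} (c : En n) (t : ℝ) :
    ball c t ⊆ interior (cubeSet c t) := by
  apply interior_maximal _ isOpen_ball
  intro y hy i
  have h1 : ‖(y - c) i‖ ≤ ‖y - c‖ := PiLp.norm_apply_le _ _
  rw [mem_ball, dist_eq_norm] at hy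
  have h2 : |y i - c i| ≤ ‖y - c‖ := by simpa using h1
  linarith

/-- Whitney geometry at a point `x` off `D`, for a cube whose dilate comes near `x`. -/
theorem whitney_geom {n : ℕ} (hn : 0 < n) (D : Set (En n)) (hne : D.Nonempty)
    (c : En n) (ρ : ℝ) (hρ : 0 < ρ)
    (hw1 : 10 * diam (cubeSet c ρ) ≤ setDist (cubeSet c ρ) D)
    (hw2 : setDist (cubeSet c ρ) D ≤ 22 * diam (cubeSet c ρ))
    (q : En n) (hq : q ∈ D) (hqd : Metric.infDist q (cubeSet c ρ) = setDist (cubeSet c ρ) D)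
    (x y : En n) (hxy : dist y x < infDist x D / 4) (hy : y ∈ cubeSet c (1.1 * ρ)) :
    infDist x D ≤ 34 * diam (cubeSet c ρ) ∧ diam (cubeSet c ρ) ≤ infDist x D ∧
      dist x q ≤ 26 * infDist x D ∧ dist c x ≤ 2 * infDist x D := by
  have hsn : 0 < Real.sqrt n := Real.sqrt_pos.2 (by exact_mod_cast hn)
  set δ := diam (cubeSet c ρ) with hδ
  have hδe : δ = 2 * Real.sqrt n * ρ := cube_diam c ρ hρ.le
  have hδ0 : 0 < δ := by rw [hδe]; positivity
  have hcQ : c ∈ cubeSet c ρ := by intro i; simp [hρ.le]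
  have hyc : dist y c ≤ δ := by
    have := cube_dist_center c y _ hy
    rw [abs_of_nonneg (by positivity)] at this
    nlinarith [mul_pos hsn hρ]
  set d := infDist x D with hd
  have hlow : 10 * δ ≤ dist x c + d := by
    have h1 : ∀ b ∈ D, 10 * δ - dist x c ≤ dist x b := by
      intro b hb
      have h2 := setDist_le _ D c b hcQ hb
      have h3 := dist_triangle_left c b x
      linarith
    have := (le_infDist hne).2 (fun {b} hb => h1 b hb)
    linarith
  have hxc : dist x c ≤ d / 4 + δ := by
    have := dist_triangle_left x c y
    linarith
  have hqc : dist c q ≤ 24 * δ := by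
    have hlt : infDist q (cubeSet c ρ) < 23 * δ := by rw [hqd]; linarith
    obtain ⟨z, hz, hzd⟩ := (infDist_lt_iff ⟨c, hcQ⟩).1 hlt
    have h1 : dist c z ≤ δ := dist_le_diam_of_mem (cube_bounded c ρ) hcQ hz
    have h2 := dist_triangle_right c q z
    linarith
  have hdq : d ≤ dist x q := infDist_le_dist_of_mem hq
  have hxq : dist x q ≤ dist x c + dist c q := dist_triangle _ _ _
  have : dist c x = dist x c := dist_comm _ _
  refine ⟨?_, ?_, ?_, ?_⟩ <;> linarith

theorem packing {n : ℕ} (hn : 0 < n) {ι : Type*} (s : Finset ι) (c : ι → En n) (x : En n)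
    (r R : ℝ) (hr : 0 < r) (hR : 0 ≤ R)
    (hc : ∀ i ∈ s, dist (c i) x ≤ R)
    (hd : ∀ i ∈ s, ∀ j ∈ s, i ≠ j → Disjoint (ball (c i) r) (ball (c j) r)) :
    (s.card : ℝ) ≤ ((R + r) / r) ^ n := by
  have : Nonempty (Fin n) := ⟨⟨0, hn⟩⟩
  have hsub : (⋃ i ∈ s, ball (c i) r) ⊆ ball x (R + r) := by
    intro y hy
    simp only [mem_iUnion] at hy
    obtain ⟨i, hi, hy⟩ := hy
    have h1 := hc i hi
    have h2 := dist_triangle y (c i) x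
    rw [mem_ball] at hy ⊢
    linarith
  have hvol := measure_mono (μ := (volume : Measure (En n))) hsub
  rw [measure_biUnion_finset (fun i hi j hj hij => hd i hi j hj hij)
    (fun i _ => measurableSet_ball)] at hvol
  have hb : ∀ (z : En n) (t : ℝ), 0 ≤ t → volume (ball z t) =
      ENNReal.ofReal (t ^ n) * volume (ball (0 : En n) 1) := by
    intro z t ht
    have := Measure.addHaar_ball (volume : Measure (En n)) z ht
    simpa using this
  have hfin : volume (ball (0 : En n) 1) ≠ ⊤ := measure_ball_lt_top.ne
  have hpos : volume (ball (0 : En n) 1) ≠ 0 := (measure_ball_pos _ _ one_pos).ne'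
  rw [Finset.sum_congr rfl (fun i _ => hb (c i) r hr.le), hb x (R + r) (by positivity),
    Finset.sum_const, nsmul_eq_mul, ← mul_assoc,
    ENNReal.mul_le_mul_iff_left hpos hfin, ← ENNReal.ofReal_natCast,
    ← ENNReal.ofReal_mul (by positivity), ENNReal.ofReal_le_ofReal_iff (by positivity)] at hvol
  rw [div_pow, le_div_iff₀ (by positivity)]
  exact hvol

theorem theta_norm {n : ℕ} {ι : Type} (δ : ι → ℝ) (hδ : ∀ i, 0 ≤ δ i) (θ : ι → En n → ℝ)
    (hθs : ∀ i, ContDiff ℝ (⊤ : ℕ∞) (θ i))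
    (hθder : ∀ k : Fin n → ℕ, ∃ Cnk > 0, ∀ i x, |mderiv k (θ i) x| * δ i ^ (∑ j, k j) ≤ Cnk) :
    ∃ A : ℕ → ℝ, (∀ j, 0 ≤ A j) ∧ ∀ j i x, ‖iteratedFDeriv ℝ j (θ i) x‖ * δ i ^ j ≤ A j := by
  choose C hC0 hC using hθder
  refine ⟨fun j => ∑ w : Fin j → Fin n, C (fun a => (List.ofFn w).count a),
    fun j => Finset.sum_nonneg fun w _ => (hC0 _).le, ?_⟩
  intro j i x
  have hp : 0 ≤ δ i ^ j := pow_nonneg (hδ i) j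
  refine (mul_le_mul_of_nonneg_right (norm_multi_le _) hp).trans ?_
  rw [Finset.sum_mul]
  apply Finset.sum_le_sum
  intro w _
  rw [iter_basis w _ ((hθs i).of_le (by exact_mod_cast le_top))]
  have := hC (fun a => (List.ofFn w).count a) i x
  rwa [sum_count, List.length_ofFn] at this

/-- Finiteness and uniform bound for the number of cubes near a point. -/
theorem whitney_finite {n : ℕ} (hn : 0 < n) (ι : Type) (c : ι → En n) (ρ : ι → ℝ)
    (hdisj : ∀ i j, i ≠ j →
      interior (cubeSet (c i) (ρ i)) ∩ interior (cubeSet (c j) (ρ j)) = ∅)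
    (x : En n) (d : ℝ) (hd : 0 < d) (I : Set ι)
    (hI : ∀ i ∈ I, d / (68 * Real.sqrt n) ≤ ρ i ∧ dist (c i) x ≤ 2 * d) :
    ∀ s : Finset ι, (s : Set ι) ⊆ I → (s.card : ℝ) ≤ (136 * Real.sqrt n + 1) ^ n := by
  intro s hs
  have hsn : 0 < Real.sqrt n := Real.sqrt_pos.2 (by exact_mod_cast hn)
  have := packing hn s c x (d / (68 * Real.sqrt n)) (2 * d) (by positivity) (by positivity)
    (fun i hi => (hI i (hs hi)).2) (fun i hi j hj hij => by
      have h1 := hdisj i j hij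
      rw [← disjoint_iff_inter_eq_empty] at h1
      refine h1.mono ?_ ?_
      · exact (ball_subset_ball (hI i (hs hi)).1).trans (ball_subset_interior _ _)
      · exact (ball_subset_ball (hI j (hs hj)).1).trans (ball_subset_interior _ _))
  refine this.trans (le_of_eq ?_)
  congr 1
  field_simp
  ring

theorem finite_of_card_le {ι : Type*} (I : Set ι) (B : ℝ)
    (h : ∀ s : Finset ι, (s : Set ι) ⊆ I → (s.card : ℝ) ≤ B) : I.Finite := by
  by_contra hinf
  obtain ⟨N, hN⟩ := exists_nat_gt B
  obtain ⟨t, ht, hc⟩ := Set.Infinite.exists_subset_card_eq hinf N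
  have := h t ht
  rw [hc] at this
  linarith

/-- The Leibniz estimate for one cube. -/
theorem leibniz_bound {n : ℕ} (m k : ℕ) (hk : k ≤ m) (F : En n → ℝ) (hF : ContDiff ℝ (m : ℕ∞) F)
    (θ : En n → ℝ) (hθ : ContDiff ℝ (⊤ : ℕ∞) θ) (A : ℕ → ℝ) (q x : En n) (δ d ε : ℝ)
    (hδ : 0 < δ) (hd : 0 < d)
    (hA : ∀ j, ‖iteratedFDeriv ℝ j θ x‖ * δ ^ j ≤ A j)
    (hdδ : d ≤ 34 * δ) (hxq : dist x q ≤ 26 * d)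
    (hε : ∀ t ∈ closedBall q (26 * d), ‖iteratedFDeriv ℝ m F t - iteratedFDeriv ℝ m F q‖ ≤ ε) :
    ‖iteratedFDeriv ℝ k (fun y => θ y * (taylorJ m F q - F) y) x‖ ≤
      (∑ j ∈ Finset.range (k + 1), (k.choose j : ℝ) * A j * 34 ^ j * 26 ^ (m - k + j)) *
        ε * d ^ (m - k) := by
  have hε0 : 0 ≤ ε := (norm_nonneg _).trans (hε q (mem_closedBall_self (by positivity)))
  have hR : ContDiff ℝ (m : ℕ∞) (taylorJ m F q - F) :=
    ((taylorJ_contDiff m F q).of_le (by exact_mod_cast le_top)).sub hF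
  have h1 := norm_iteratedFDeriv_mul_le (N := (m : ℕ∞))
    (hθ.of_le (by exact_mod_cast le_top)) hR x (n := k) (by exact_mod_cast hk)
  refine h1.trans ?_
  rw [Finset.sum_mul, Finset.sum_mul]
  apply Finset.sum_le_sum
  intro j hj
  have hjk : j ≤ k := by simpa [Nat.lt_succ_iff] using hj
  have h2 := taylor_remainder m F hF q (26 * d) ε (by positivity) hε (m - k + j) (by omega) x hxq
  have e : m - (m - k + j) = k - j := by omega
  rw [e] at h2
  have h3 : ‖iteratedFDeriv ℝ j θ x‖ * d ^ j ≤ A j * 34 ^ j := by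
    calc ‖iteratedFDeriv ℝ j θ x‖ * d ^ j ≤ ‖iteratedFDeriv ℝ j θ x‖ * (34 * δ) ^ j := by gcongr
      _ = (‖iteratedFDeriv ℝ j θ x‖ * δ ^ j) * 34 ^ j := by rw [mul_pow]; ring
      _ ≤ _ := by gcongr; exact hA j
  calc (k.choose j : ℝ) * ‖iteratedFDeriv ℝ j θ x‖ * ‖iteratedFDeriv ℝ (k - j) (taylorJ m F q - F) x‖
      ≤ (k.choose j : ℝ) * ‖iteratedFDeriv ℝ j θ x‖ * (ε * (26 * d) ^ (m - k + j)) := by gcongr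
    _ = (k.choose j : ℝ) * (‖iteratedFDeriv ℝ j θ x‖ * d ^ j) * (ε * 26 ^ (m - k + j) * d ^ (m - k)) := by
        rw [mul_pow, pow_add d]; ring
    _ ≤ (k.choose j : ℝ) * (A j * 34 ^ j) * (ε * 26 ^ (m - k + j) * d ^ (m - k)) := by gcongr
    _ = _ := by ring

/-- Whitney extension lemma (Lemma 10 of the paper): gluing the Taylor polynomials
`J^m_{x_Q}F` with a Whitney partition of unity produces a `C^m` function `G` whose
derivatives up to order `m` agree with those of `F` on `D`. -/
theorem stmt19 {n : ℕ} (hn : 0 < n) (D : Set (En n)) (hne : D.Nonempty) (hcl : IsClosed D)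
    (ι : Type) [Countable ι] (c : ι → En n) (ρ : ι → ℝ) (hρ : ∀ i, 0 < ρ i)
    (hdisj : ∀ i j, i ≠ j →
      interior (cubeSet (c i) (ρ i)) ∩ interior (cubeSet (c j) (ρ j)) = ∅)
    (hcover : (⋃ i, cubeSet (c i) (ρ i)) = Dᶜ)
    (hw1 : ∀ i, 10 * diam (cubeSet (c i) (ρ i)) ≤ setDist (cubeSet (c i) (ρ i)) D)
    (hw2 : ∀ i, setDist (cubeSet (c i) (ρ i)) D ≤ 22 * diam (cubeSet (c i) (ρ i)))
    (hcomp : ∀ i j, (cubeSet (c i) (ρ i) ∩ cubeSet (c j) (ρ j)).Nonempty →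
      diam (cubeSet (c i) (ρ i)) ≤ 2 * diam (cubeSet (c j) (ρ j)))
    (θ : ι → En n → ℝ) (hθs : ∀ i, ContDiff ℝ (⊤ : ℕ∞) (θ i))
    (hθ01 : ∀ i x, 0 ≤ θ i x ∧ θ i x ≤ 1)
    (hθsupp : ∀ i x, x ∉ cubeSet (c i) (1.1 * ρ i) → θ i x = 0)
    (hθsum : ∀ x, x ∉ D → HasSum (fun i => θ i x) 1)
    (hθder : ∀ k : Fin n → ℕ, ∃ Cnk > 0, ∀ i x,
      |mderiv k (θ i) x| * diam (cubeSet (c i) (ρ i)) ^ (∑ j, k j) ≤ Cnk)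
    (xQ : ι → En n) (hxQ : ∀ i, xQ i ∈ D)
    (hxQd : ∀ i, Metric.infDist (xQ i) (cubeSet (c i) (ρ i)) = setDist (cubeSet (c i) (ρ i)) D)
    (m : ℕ) (F : En n → ℝ) (hF : ContDiff ℝ (m : ℕ∞) F)
    (G : En n → ℝ)
    (hG1 : ∀ x ∈ D, G x = F x)
    (hG2 : ∀ x, x ∉ D → G x = ∑' i, θ i x * taylorJ m F (xQ i) x) :
    ContDiff ℝ (m : ℕ∞) G ∧
      ∀ x ∈ D, ∀ k : Fin n → ℕ, ∑ j, k j ≤ m → mderiv k G x = mderiv k F x := by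
  classical
  have hsn : 0 < Real.sqrt n := Real.sqrt_pos.2 (by exact_mod_cast hn)
  set δ : ι → ℝ := fun i => diam (cubeSet (c i) (ρ i)) with hδdef
  have hδe : ∀ i, δ i = 2 * Real.sqrt n * ρ i := fun i => cube_diam _ _ (hρ i).le
  have hδ0 : ∀ i, 0 < δ i := fun i => by rw [hδe]; have := hρ i; positivity
  obtain ⟨A, hA0, hA⟩ := theta_norm δ (fun i => (hδ0 i).le) θ hθs hθder
  set N : ℝ := (136 * Real.sqrt n + 1) ^ n with hN
  have hN0 : 0 ≤ N := by positivity
  set K : ℕ → ℝ := fun k =>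
    ∑ j ∈ Finset.range (k + 1), (k.choose j : ℝ) * A j * 34 ^ j * 26 ^ (m - k + j) with hK
  have hK0 : ∀ k, 0 ≤ K k := fun k => Finset.sum_nonneg fun j _ => by
    have := hA0 j
    positivity
  -- the local structure of `H = G - F` off `D`
  have hloc : ∀ x ∉ D, 0 < infDist x D ∧ ∃ I : Finset ι, (I.card : ℝ) ≤ N ∧
      (∀ i ∈ I, infDist x D ≤ 34 * δ i ∧ dist x (xQ i) ≤ 26 * infDist x D) ∧
      (G - F) =ᶠ[nhds x] fun y => ∑ i ∈ I, θ i y * (taylorJ m F (xQ i) - F) y := by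
    intro x hx
    have hd : 0 < infDist x D := (hcl.notMem_iff_infDist_pos hne).1 hx
    refine ⟨hd, ?_⟩
    set d := infDist x D with hddef
    let I : Set ι := {i | ∃ y, dist y x < d / 4 ∧ y ∈ cubeSet (c i) (1.1 * ρ i)}
    have hgeom : ∀ i ∈ I, d ≤ 34 * δ i ∧ δ i ≤ d ∧
      dist x (xQ i) ≤ 26 * d ∧ dist (c i) x ≤ 2 * d := by
      rintro i ⟨y, hy1, hy2⟩
      exact whitney_geom hn D hne (c i) (ρ i) (hρ i) (hw1 i) (hw2 i) (xQ i) (hxQ i) (hxQd i)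
        x y hy1 hy2
    have hcard := whitney_finite hn ι c ρ hdisj x d hd I (fun i hi => by
      obtain ⟨h1, -, -, h4⟩ := hgeom i hi
      refine ⟨?_, h4⟩
      rw [div_le_iff₀ (by positivity)]
      rw [hδe] at h1
      linarith)
    have hfin : I.Finite := finite_of_card_le I _ hcard
    refine ⟨hfin.toFinset, hcard _ (by simp), ?_, ?_⟩
    · intro i hi
      have := hgeom i (by simpa using hi)
      exact ⟨this.1, this.2.2.1⟩
    · filter_upwards [ball_mem_nhds x (show 0 < d / 4 by positivity)] with y hy
      have hyD : y ∉ D := by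
        intro hyD
        have h1 : d ≤ dist x y := infDist_le_dist_of_mem hyD
        rw [mem_ball, dist_comm] at hy
        linarith
      have hz : ∀ i ∉ hfin.toFinset, θ i y = 0 := by
        intro i hi
        apply hθsupp
        intro hc
        apply hi
        simp only [Set.Finite.mem_toFinset]
        exact ⟨y, hy, hc⟩
      have hs1 : ∑ i ∈ hfin.toFinset, θ i y = 1 :=
        (hasSum_sum_of_ne_finset_zero hz).unique (hθsum y hyD)
      have hs2 : G y = ∑ i ∈ hfin.toFinset, θ i y * taylorJ m F (xQ i) y := by
        rw [hG2 y hyD]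
        apply tsum_eq_sum
        intro i hi
        rw [hz i hi, zero_mul]
      simp only [Pi.sub_apply, mul_sub, Finset.sum_sub_distrib, ← Finset.sum_mul, hs1, hs2, one_mul]
  have hR : ∀ q, ContDiff ℝ (m : ℕ∞) (taylorJ m F q - F) := fun q =>
    ((taylorJ_contDiff m F q).of_le (by exact_mod_cast le_top)).sub hF
  have hθR : ∀ i, ContDiff ℝ (m : ℕ∞) (fun y => θ i y * (taylorJ m F (xQ i) - F) y) := fun i =>
    ((hθs i).of_le (by exact_mod_cast le_top)).mul (hR _)
  have hbound : ∀ x ∉ D, ∀ k ≤ m, ∀ ε, 0 ≤ ε → (∀ q ∈ D, dist x q ≤ 26 * infDist x D →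
      ∀ t ∈ closedBall q (26 * infDist x D),
        ‖iteratedFDeriv ℝ m F t - iteratedFDeriv ℝ m F q‖ ≤ ε) →
      ‖iteratedFDeriv ℝ k (G - F) x‖ ≤ N * (K k * ε * infDist x D ^ (m - k)) := by
    intro x hx k hk ε hε0 hε
    obtain ⟨hd, I, hI1, hI2, hI3⟩ := hloc x hx
    rw [(hI3.iteratedFDeriv ℝ k).eq_of_nhds]
    rw [iteratedFDeriv_fun_sum_apply (fun i _ =>
      ((hθR i).of_le (by exact_mod_cast hk)).contDiffAt)]
    refine (norm_sum_le _ _).trans ?_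
    have : ∀ i ∈ I, ‖iteratedFDeriv ℝ k (fun y => θ i y * (taylorJ m F (xQ i) - F) y) x‖ ≤
        K k * ε * infDist x D ^ (m - k) := by
      intro i hi
      obtain ⟨h1, h2⟩ := hI2 i hi
      exact leibniz_bound m k hk F hF (θ i) (hθs i) A (xQ i) x (δ i) _ ε (hδ0 i) hd
        (fun j => hA j i x) h1 h2 (hε _ (hxQ i) h2)
    refine (Finset.sum_le_card_nsmul _ _ _ this).trans ?_
    rw [nsmul_eq_mul]
    have := hK0 k
    gcongr
  have hglue := glue_lemma D hcl m (G - F) (fun x hx => by simp [hG1 x hx])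
    (fun x hx => by
      obtain ⟨hd, I, hI1, hI2, hI3⟩ := hloc x hx
      refine ContDiffAt.congr_of_eventuallyEq ?_ hI3
      exact (ContDiff.sum fun i _ => hθR i).contDiffAt)
    (by
      intro x₀ hx₀ k hk ε hε
      have hcont : Continuous (iteratedFDeriv ℝ m F) := hF.continuous_iteratedFDeriv le_rfl
      have hNK : 0 ≤ N * K k := mul_nonneg hN0 (hK0 k)
      set e := ε / (2 * (N * K k + 1)) with he
      have he0 : 0 < e := by positivity
      obtain ⟨η, hη, hηc⟩ := Metric.continuousAt_iff.1 (hcont.continuousAt (x := x₀)) e he0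
      refine ⟨η / 53, by positivity, ?_⟩
      intro x hx hxx
      have hdx : infDist x D ≤ dist x x₀ := infDist_le_dist_of_mem hx₀
      have hb := hbound x hx k hk (2 * e) (by positivity) (by
        intro q hq hxq t ht
        rw [mem_closedBall] at ht
        have hq1 : dist q x₀ < η := by
          have := dist_triangle_left q x₀ x
          have := dist_nonneg (x := x) (y := x₀)
          linarith
        have ht1 : dist t x₀ < η := by
          have := dist_triangle t q x₀
          have := dist_triangle_left q x₀ x
          linarith
        have h1 := hηc hq1
        have h2 := hηc ht1
        rw [← dist_eq_norm]
        have := dist_triangle_right (iteratedFDeriv ℝ m F t) (iteratedFDeriv ℝ m F q)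
          (iteratedFDeriv ℝ m F x₀)
        linarith)
      refine hb.trans ?_
      have hpow : infDist x D ^ (m - k) ≤ dist x x₀ ^ (m - k) :=
        pow_le_pow_left₀ infDist_nonneg hdx _
      have hcoef : N * K k * (2 * e) ≤ ε := by
        rw [he]
        have hp : 0 < N * K k + 1 := by positivity
        have : N * K k * (2 * (ε / (2 * (N * K k + 1)))) = (N * K k) * ε / (N * K k + 1) := by
          field_simp
        rw [this, div_le_iff₀ hp]
        nlinarith
      calc N * (K k * (2 * e) * infDist x D ^ (m - k))
          = (N * K k * (2 * e)) * infDist x D ^ (m - k) := by ring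
        _ ≤ ε * dist x x₀ ^ (m - k) :=
          mul_le_mul hcoef hpow (pow_nonneg infDist_nonneg _) hε.le)
  obtain ⟨hH, hH0⟩ := hglue
  have hGe : G = F + (G - F) := by simp
  have hGc : ContDiff ℝ (m : ℕ∞) G := by
    rw [hGe]; exact hF.add hH
  refine ⟨hGc, ?_⟩
  intro x hx k hk
  rw [mderiv_eq_iter k G (hGc.of_le (by exact_mod_cast hk)),
    mderiv_eq_iter k F (hF.of_le (by exact_mod_cast hk))]
  have hl : (wordOf k).length ≤ m := by rw [wordOf_length]; exact hk
  have : iteratedFDeriv ℝ (wordOf k).length G x = iteratedFDeriv ℝ (wordOf k).length F x := by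
    conv_lhs => rw [hGe]
    rw [iteratedFDeriv_add_apply (hF.of_le (by exact_mod_cast hl)).contDiffAt
      (hH.of_le (by exact_mod_cast hl)).contDiffAt, hH0 x hx _ hl, add_zero]
  rw [this]
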